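/- Local character of the matroid independence relation: let cl be a finitary matroid on a type α and let ⫫ be the induced independence relation. Then for all A, B ⊆ α there exists C ⊆ B such that the cardinality of C is at most ℵ₀ + #A and A ⫫_C B. -/

import Mathlib

open Set

/-- A finitary matroid (pregeometry) on `α`: a closure operator satisfying
extension, monotonicity, idempotency, finitary character, and the exchange principle. -/
structure IsFinMatroid {α : Type*} (cl : Set α → Set α) : Prop where
  subset_cl : ∀ X : Set α, X ⊆ cl X
  mono : ∀ ⦃X Y : Set α⦄, X ⊆ Y → cl X ⊆ cl Y
  idem : ∀ X : Set α, cl (cl X) = cl X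
  finitary : ∀ X : Set α, cl X = ⋃ A ∈ {A : Set α | A ⊆ X ∧ A.Finite}, cl A
  exchange : ∀ ⦃X : Set α⦄ ⦃a c : α⦄, a ∈ cl (X ∪ {c}) → a ∉ cl X → c ∈ cl (X ∪ {a})

/-- `ClIndep cl B S` : the set `S` is `cl`-independent over `B`. -/
def ClIndep {α : Type*} (cl : Set α → Set α) (B S : Set α) : Prop :=
  ∀ a ∈ S, a ∉ cl (B ∪ (S \ {a}))

/-- `ClInd cl A B C` means `A ⫫_B C` : every `Z' ⊆ C` that is `cl`-independent over `B`
is also `cl`-independent over `B ∪ A`. -/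
def ClInd {α : Type*} (cl : Set α → Set α) (A B C : Set α) : Prop :=
  ∀ Z' : Set α, Z' ⊆ C → ClIndep cl B Z' → ClIndep cl (B ∪ A) Z'

/-- The relative rank `RK(A/B)`: the supremum of the cardinalities of subsets of `A`
that are `cl`-independent over `B`. -/
noncomputable def ClRK {α : Type*} (cl : Set α → Set α) (A B : Set α) : Cardinal :=
  ⨆ S : {S : Set α // S ⊆ A ∧ ClIndep cl B S}, Cardinal.mk S.1

namespace IsFinMatroid

variable {α : Type*} {cl : Set α → Set α}

lemma exists_finite_subset (hcl : IsFinMatroid cl) {X : Set α} {a : α} (ha : a ∈ cl X) :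
    ∃ F ⊆ X, F.Finite ∧ a ∈ cl F := by
  rw [hcl.finitary] at ha
  simpa [and_assoc] using ha

lemma cl_subset_of_subset_cl (hcl : IsFinMatroid cl) {X Y : Set α} (h : X ⊆ cl Y) :
    cl X ⊆ cl Y :=
  hcl.idem Y ▸ hcl.mono h

/-- Independence over a fixed set is preserved under unions of nonempty chains. -/
lemma clIndep_sUnion_of_isChain (hcl : IsFinMatroid cl) {B : Set α} {c : Set (Set α)}
    (hc : IsChain (· ⊆ ·) c) (hne : c.Nonempty) (hind : ∀ s ∈ c, ClIndep cl B s) :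
    ClIndep cl B (⋃₀ c) := by
  intro a ha hacl
  obtain ⟨F, hF, hfin, haF⟩ := hcl.exists_finite_subset hacl
  have hsub : insert a (F \ B) ⊆ ⋃₀ c :=
    insert_subset ha fun x hx => ((hF hx.1).resolve_left hx.2).1
  obtain ⟨s, hs, hFs⟩ := hc.directedOn.exists_mem_subset_of_finite_of_subset_sUnion hne
    ((hfin.subset sdiff_subset).insert a) hsub
  refine hind s hs a (hFs (mem_insert _ _)) (hcl.mono (fun x hx => ?_) haF)
  by_cases hxB : x ∈ B
  · exact Or.inl hxB
  · exact Or.inr ⟨hFs (Or.inr ⟨hx, hxB⟩), ((hF hx).resolve_left hxB).2⟩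

lemma clIndep_insert (hcl : IsFinMatroid cl) {B S : Set α} {a : α} (hS : ClIndep cl B S)
    (ha : a ∉ cl (B ∪ S)) : ClIndep cl B (insert a S) := by
  rintro x (rfl | hx) hxcl
  · exact ha (hcl.mono (by grind) hxcl)
  · have hexch := hcl.exchange (X := B ∪ (S \ {x})) (a := x) (c := a)
      (hcl.mono (by grind) hxcl) (hS x hx)
    exact ha (hcl.mono (by grind) hexch)

/-- Every set `A` has a basis over `B`. -/
lemma exists_clIndep_subset_cl (hcl : IsFinMatroid cl) (A B : Set α) :
    ∃ S ⊆ A, ClIndep cl B S ∧ A ⊆ cl (B ∪ S) := by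
  obtain ⟨S, hS⟩ := zorn_subset {S : Set α | S ⊆ A ∧ ClIndep cl B S} fun c hcs hc => by
    rcases c.eq_empty_or_nonempty with rfl | hne
    · exact ⟨∅, ⟨empty_subset _, fun a ha => ha.elim⟩, by simp⟩
    · exact ⟨⋃₀ c, ⟨sUnion_subset fun s hs => (hcs hs).1,
        hcl.clIndep_sUnion_of_isChain hc hne fun s hs => (hcs hs).2⟩,
        fun s hs => subset_sUnion_of_mem hs⟩
  refine ⟨S, hS.prop.1, hS.prop.2, fun a ha => ?_⟩
  by_contra hacl
  have haS : a ∈ S := hS.le_of_ge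
    ⟨insert_subset ha hS.prop.1, hcl.clIndep_insert hS.prop.2 hacl⟩
    (subset_insert a S) (mem_insert a S)
  exact hacl (hcl.subset_cl _ (Or.inr haS))

/-- Elements of `B` that depend on a subset of `B` together with a set independent over `B`
already depend on that subset of `B`. -/
lemma mem_cl_of_mem_cl_union (hcl : IsFinMatroid cl) {B S X : Set α} {z : α}
    (hS : ClIndep cl B S) (hX : X ⊆ B) (hz : z ∈ B) (hzcl : z ∈ cl (X ∪ S)) : z ∈ cl X := by
  obtain ⟨F, hF, hfin, hzF⟩ := hcl.exists_finite_subset hzcl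
  suffices h : ∀ G : Set α, G.Finite → G ⊆ S → z ∈ cl (X ∪ G) → z ∈ cl X from
    h (F \ X) (hfin.subset sdiff_subset) (by grind) (hcl.mono (by grind) hzF)
  intro G hG
  induction G, hG using Set.Finite.induction_on with
  | empty => simp
  | @insert a G haG _ ih =>
    intro hGS hzG
    refine ih ((subset_insert a G).trans hGS) ?_
    by_contra hzn
    have hexch := hcl.exchange (X := X ∪ G) (a := z) (c := a) (hcl.mono (by grind) hzG) hzn
    exact hS a (hGS (mem_insert a G)) (hcl.mono (by grind) hexch)

/-- If `A` depends on `C ∪ S`, where `C ⊆ B` and `S` is independent over `B`, then `A ⫫_C B`. -/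
lemma clInd_of_subset_cl (hcl : IsFinMatroid cl) {A B C S : Set α} (hC : C ⊆ B)
    (hS : ClIndep cl B S) (hA : A ⊆ cl (C ∪ S)) : ClInd cl A C B := by
  intro Z hZ hind z hz hzcl
  refine hind z hz (hcl.mem_cl_of_mem_cl_union hS (union_subset hC (sdiff_subset.trans hZ))
    (hZ hz) (hcl.cl_subset_of_subset_cl ?_ hzcl))
  have h₁ : A ⊆ cl (C ∪ Z \ {z} ∪ S) := hA.trans (hcl.mono (by grind))
  have h₂ := hcl.subset_cl (C ∪ Z \ {z} ∪ S)
  grind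

end IsFinMatroid

/-- Local character of the matroid independence relation: for all `A, B ⊆ α`
there exists `C ⊆ B` with `#C ≤ ℵ₀ + #A` and `A ⫫_C B`. -/
theorem clInd_local_character {α : Type*} {cl : Set α → Set α}
    (hcl : IsFinMatroid cl) (A B : Set α) :
    ∃ C : Set α, C ⊆ B ∧ Cardinal.mk C ≤ Cardinal.aleph0 + Cardinal.mk A ∧
      ClInd cl A C B := by
  obtain ⟨S, -, hS, hA⟩ := hcl.exists_clIndep_subset_cl A B
  have hfin (a : A) : ∃ F ⊆ B, F.Finite ∧ (a : α) ∈ cl (F ∪ S) := by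
    obtain ⟨F, hF, hfin, haF⟩ := hcl.exists_finite_subset (hA a.2)
    exact ⟨F ∩ B, inter_subset_right, hfin.subset inter_subset_left,
      hcl.mono (by grind) haF⟩
  choose F hFB hF haF using hfin
  refine ⟨⋃ a, F a, iUnion_subset hFB, ?_, ?_⟩
  · calc Cardinal.mk (⋃ a, F a) ≤ Cardinal.mk A * ⨆ a, Cardinal.mk (F a) :=
          Cardinal.mk_iUnion_le _
      _ ≤ Cardinal.mk A * Cardinal.aleph0 := by
          gcongr
          exact ciSup_le' fun a => (hF a).countable.le_aleph0
      _ ≤ max (max (Cardinal.mk A) Cardinal.aleph0) Cardinal.aleph0 := Cardinal.mul_le_max _ _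
      _ ≤ Cardinal.aleph0 + Cardinal.mk A := by simp
  · exact hcl.clInd_of_subset_cl (iUnion_subset hFB) hS fun a ha =>
      hcl.mono (union_subset_union_left S (subset_iUnion F ⟨a, ha⟩)) (haF ⟨a, ha⟩)
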